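/- Let ε > 0 and let n be an integer with εn ≥ 3. Let H be a 3-uniform hypergraph on n vertices with δ₂(H) ≥ (1/3 + ε)n containing no homomorphic copy of the tight cycle C₁₁. Then for every edge {x,y,z} ∈ E(H) there is a labeling of its three vertices as x, y, z such that among the six possible arcs on {x,y,z}, the apex digraph D contains exactly the two arcs y → x and z → x, and among the three pairs contained in {x,y,z}, the pair {y,z} is the unique base pair. -/

import Mathlib

open Finset

/-- A 3-uniform hypergraph given by its edge set: every edge has exactly 3 vertices. -/
def IsUniform3 {V : Type*} (H : Finset (Finset V)) : Prop :=
  ∀ e ∈ H, e.card = 3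

/-- The codegree of a pair of vertices: the number of vertices `w` with `{u,v,w} ∈ H`. -/
noncomputable def codeg {V : Type*} [DecidableEq V] (H : Finset (Finset V)) (u v : V) : ℕ :=
  {w : V | ({u, v, w} : Finset V) ∈ H}.ncard

/-- The minimum codegree `δ₂(H)`: the minimum of `codeg H u v` over pairs of distinct vertices. -/
noncomputable def minCodeg {V : Type*} [DecidableEq V] (H : Finset (Finset V)) : ℕ :=
  sInf {d : ℕ | ∃ u v : V, u ≠ v ∧ codeg H u v = d}

/-- `H` contains a homomorphic copy of the tight cycle `C_ℓ`: a cyclic sequence of vertices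
(indexed by `ZMod ℓ`, not necessarily distinct) in which every three cyclically consecutive
vertices are pairwise distinct and form an edge of `H`. -/
def HasHomTightCycle {V : Type*} [DecidableEq V] (ℓ : ℕ) (H : Finset (Finset V)) : Prop :=
  ∃ x : ZMod ℓ → V, ∀ i : ZMod ℓ,
    x (i - 1) ≠ x i ∧ x i ≠ x (i + 1) ∧ x (i - 1) ≠ x (i + 1) ∧
      ({x (i - 1), x i, x (i + 1)} : Finset V) ∈ H

/-- `H` contains a (genuine) copy of the tight cycle `C_ℓ`: `ℓ` distinct vertices, cyclically
ordered, such that every three cyclically consecutive vertices form an edge of `H`. -/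
def HasTightCycle {V : Type*} [DecidableEq V] (ℓ : ℕ) (H : Finset (Finset V)) : Prop :=
  ∃ x : ZMod ℓ → V, Function.Injective x ∧
    ∀ i : ZMod ℓ, ({x (i - 1), x i, x (i + 1)} : Finset V) ∈ H

/-- The arc `u → v` of the apex digraph `D`: some `K₄⁻` of `H` contains `u` and `v`
with apex `v`; i.e. there are two further vertices `a, b` (with `u,v,a,b` distinct)
such that the three edges through `v` on `{u,v,a,b}` all lie in `H`. -/
def ArcD {V : Type*} [DecidableEq V] (H : Finset (Finset V)) (u v : V) : Prop :=
  ∃ a b : V, ({u, v, a, b} : Finset V).card = 4 ∧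
    ({v, u, a} : Finset V) ∈ H ∧ ({v, u, b} : Finset V) ∈ H ∧ ({v, a, b} : Finset V) ∈ H

/-- `{u,v}` is a base pair: some `K₄⁻` of `H` contains `u` and `v` with neither `u` nor
`v` being the apex; i.e. there are further vertices `w, a` (with `u,v,w,a` distinct) with
apex `w`, so that the three edges through `w` on `{u,v,w,a}` all lie in `H`. -/
def BasePair {V : Type*} [DecidableEq V] (H : Finset (Finset V)) (u v : V) : Prop :=
  ∃ w a : V, ({u, v, w, a} : Finset V).card = 4 ∧
    ({w, u, v} : Finset V) ∈ H ∧ ({w, u, a} : Finset V) ∈ H ∧ ({w, v, a} : Finset V) ∈ H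

/-- The degree of `v` in the base-pair graph `B`. -/
noncomputable def degB {V : Type*} [DecidableEq V] (H : Finset (Finset V)) (v : V) : ℕ :=
  {u : V | BasePair H u v}.ncard

/-- The out-degree of `v` in the apex digraph `D`. -/
noncomputable def outDegD {V : Type*} [DecidableEq V] (H : Finset (Finset V)) (v : V) : ℕ :=
  {u : V | ArcD H v u}.ncard

/-- The in-degree of `v` in the apex digraph `D`. -/
noncomputable def inDegD {V : Type*} [DecidableEq V] (H : Finset (Finset V)) (v : V) : ℕ :=
  {u : V | ArcD H u v}.ncard

/-- The codegree Turán number `ex₂(n, C_ℓ)`: the maximum of `δ₂(H)` over all 3-uniform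
hypergraphs `H` on `n` vertices containing no copy of the tight cycle `C_ℓ`. -/
noncomputable def exCodeg (ℓ n : ℕ) : ℕ :=
  sSup {k : ℕ | ∃ H : Finset (Finset (Fin n)),
    IsUniform3 H ∧ ¬ HasTightCycle ℓ H ∧ minCodeg H = k}

section TightWalks

variable {V : Type*} [DecidableEq V] {H : Finset (Finset V)}

theorem triple_swap {a b c : V} (h : ({a, b, c} : Finset V) ∈ H) :
    ({b, a, c} : Finset V) ∈ H := by
  rwa [Finset.insert_comm]

theorem triple_rotate {a b c : V} (h : ({a, b, c} : Finset V) ∈ H) :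
    ({b, c, a} : Finset V) ∈ H := by
  rwa [Finset.pair_comm c a, Finset.insert_comm]

theorem IsUniform3.pairwise_ne (hH : IsUniform3 H) {a b c : V}
    (h : ({a, b, c} : Finset V) ∈ H) : a ≠ b ∧ b ≠ c ∧ a ≠ c := by
  have h3 := hH _ h
  have hle (p q : V) : ({p, q} : Finset V).card ≤ 2 := Finset.card_le_two
  refine ⟨?_, ?_, ?_⟩ <;> rintro rfl
  · have := hle a c
    simp_all
  · have := hle a b
    simp_all
  · have := hle b a
    simp_all

theorem card_four_of_pairwise_ne {a b c d : V} (hab : a ≠ b) (hac : a ≠ c) (had : a ≠ d)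
    (hbc : b ≠ c) (hbd : b ≠ d) (hcd : c ≠ d) : ({a, b, c, d} : Finset V).card = 4 := by
  simp [Finset.card_insert_of_notMem, *]

theorem BasePair.symm {u v : V} (h : BasePair H u v) : BasePair H v u := by
  obtain ⟨w, a, hc, h₁, h₂, h₃⟩ := h
  exact ⟨w, a, by rwa [Finset.insert_comm], triple_rotate (triple_swap h₁), h₃, h₂⟩

/-- Eleven edges along a closed walk give a homomorphic copy of `C₁₁`. -/
theorem hasHomTightCycle_eleven (hH : IsUniform3 H) (x : Fin 11 → V)
    (hx : ∀ i : Fin 11, ({x (i - 1), x i, x (i + 1)} : Finset V) ∈ H) :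
    HasHomTightCycle 11 H := by
  refine ⟨x, fun i => ?_⟩
  obtain ⟨h₁, h₂, h₃⟩ := hH.pairwise_ne (hx i)
  exact ⟨h₁, h₂, h₃, hx i⟩

theorem ArcD.not_reverse (hH : IsUniform3 H) (hfree : ¬ HasHomTightCycle 11 H) {u v : V}
    (h : ArcD H u v) : ¬ ArcD H v u := by
  rintro ⟨c, d, -, huvc, huvd, hucd⟩
  obtain ⟨a, b, -, hvua, hvub, hvab⟩ := h
  refine hfree (hasHomTightCycle_eleven hH ![v, u, c, d, u, v, a, b, v, u, a] fun i => ?_)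
  fin_cases i
  · exact triple_rotate (triple_rotate hvua)
  · exact triple_swap huvc
  · exact hucd
  · exact triple_rotate hucd
  · exact triple_rotate (triple_rotate huvd)
  · exact triple_swap hvua
  · exact hvab
  · exact triple_rotate hvab
  · exact triple_rotate (triple_rotate hvub)
  · exact hvua
  · exact triple_rotate hvua

theorem ArcD.not_basePair (hH : IsUniform3 H) (hfree : ¬ HasHomTightCycle 11 H) {u v : V}
    (h : ArcD H u v) : ¬ BasePair H u v := by
  rintro ⟨w, c, -, hwuv, hwuc, hwvc⟩
  obtain ⟨a, b, -, hvua, hvub, hvab⟩ := h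
  refine hfree (hasHomTightCycle_eleven hH ![u, v, w, c, u, w, v, u, a, v, b] fun i => ?_)
  fin_cases i
  · exact triple_swap (triple_rotate hvub)
  · exact triple_rotate hwuv
  · exact triple_swap hwvc
  · exact triple_rotate (triple_swap hwuc)
  · exact triple_swap (triple_rotate hwuc)
  · exact triple_swap hwuv
  · exact triple_rotate (triple_swap hwuv)
  · exact hvua
  · exact triple_rotate hvua
  · exact triple_swap hvab
  · exact triple_rotate (triple_swap hvub)

/-- In the absence of `C₁₁`, a `K₄⁻` with apex `x` determines the structure of its edges. -/
theorem edge_structure_of_apex (hH : IsUniform3 H) (hfree : ¬ HasHomTightCycle 11 H)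
    {x y z w : V} (hxyz : ({x, y, z} : Finset V) ∈ H) (hxyw : ({x, y, w} : Finset V) ∈ H)
    (hxzw : ({x, z, w} : Finset V) ∈ H) :
    ArcD H y x ∧ ArcD H z x ∧
      ¬ ArcD H x y ∧ ¬ ArcD H x z ∧ ¬ ArcD H y z ∧ ¬ ArcD H z y ∧
      BasePair H y z ∧ ¬ BasePair H x y ∧ ¬ BasePair H x z := by
  obtain ⟨hxy, hyz, hxz⟩ := hH.pairwise_ne hxyz
  obtain ⟨-, hyw, hxw⟩ := hH.pairwise_ne hxyw
  obtain ⟨-, hzw, -⟩ := hH.pairwise_ne hxzw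
  have hyx : ArcD H y x :=
    ⟨z, w, card_four_of_pairwise_ne hxy.symm hyz hyw hxz hxw hzw, hxyz, hxyw, hxzw⟩
  have hzx : ArcD H z x :=
    ⟨y, w, card_four_of_pairwise_ne hxz.symm hyz.symm hzw hxy hxw hyw,
      triple_swap (triple_rotate (triple_rotate hxyz)), hxzw, hxyw⟩
  have hB : BasePair H y z :=
    ⟨x, w, card_four_of_pairwise_ne hyz hxy.symm hyw hxz.symm hzw hxw, hxyz, hxyw, hxzw⟩
  exact ⟨hyx, hzx, hyx.not_reverse hH hfree, hzx.not_reverse hH hfree,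
    fun h => h.not_basePair hH hfree hB, fun h => h.not_basePair hH hfree hB.symm, hB,
    fun h => hyx.not_basePair hH hfree h.symm, fun h => hzx.not_basePair hH hfree h.symm⟩

theorem minCodeg_le_card_filter [Fintype V] {u v : V} (huv : u ≠ v) :
    minCodeg H ≤ (univ.filter fun w => ({u, v, w} : Finset V) ∈ H).card := by
  refine (Nat.sInf_le ⟨u, v, huv, rfl⟩ : minCodeg H ≤ codeg H u v).trans_eq ?_
  rw [codeg, ← Set.ncard_coe_finset]
  simp

/-- If the minimum codegree exceeds a third of the order, every edge lies in a `K₄⁻`. -/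
theorem exists_apex_of_card_lt [Fintype V] (hH : IsUniform3 H)
    (hcard : Fintype.card V < 3 * minCodeg H) {e : Finset V} (he : e ∈ H) :
    ∃ x y z w : V, ({x, y, z} : Finset V) = e ∧
      ({x, y, w} : Finset V) ∈ H ∧ ({x, z, w} : Finset V) ∈ H := by
  obtain ⟨x, y, z, hxy, hxz, hyz, rfl⟩ := Finset.card_eq_three.mp (hH e he)
  by_contra! hno
  have h₁ := minCodeg_le_card_filter (H := H) hxy
  have h₂ := minCodeg_le_card_filter (H := H) hxz
  have h₃ := minCodeg_le_card_filter (H := H) hyz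
  set A := univ.filter fun w => ({x, y, w} : Finset V) ∈ H with hA
  set B := univ.filter fun w => ({x, z, w} : Finset V) ∈ H with hB
  set C := univ.filter fun w => ({y, z, w} : Finset V) ∈ H with hC
  have hAB : Disjoint A B := by
    refine Finset.disjoint_left.mpr fun w ha hb => ?_
    simp only [hA, hB, mem_filter, mem_univ, true_and] at ha hb
    exact hno x y z w rfl ha hb
  have hABC : Disjoint (A ∪ B) C := by
    refine Finset.disjoint_left.mpr fun w hab hc => ?_
    simp only [hA, hB, hC, mem_union, mem_filter, mem_univ, true_and] at hab hc
    rcases hab with ha | hb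
    · exact hno y x z w (Finset.insert_comm _ _ _) (triple_swap ha) hc
    · exact hno z x y w (by rw [Finset.insert_comm, Finset.pair_comm])
        (triple_swap hb) (triple_swap hc)
  have hle := Finset.card_le_univ (A ∪ B ∪ C)
  rw [Finset.card_union_of_disjoint hABC, Finset.card_union_of_disjoint hAB] at hle
  omega

end TightWalks

/-- If `ε > 0`, `εn ≥ 3` and `H` is a 3-uniform hypergraph on `n` vertices with
`δ₂(H) ≥ (1/3 + ε)n` and no homomorphic copy of `C₁₁`, then every edge of `H` admits a
labeling of its vertices as `x, y, z` so that on `{x,y,z}` the apex digraph `D` contains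
exactly the two arcs `y → x`, `z → x`, and `{y,z}` is the unique base pair. -/
theorem edge_structure_of_C11_free {n : ℕ} (ε : ℝ) (hε : 0 < ε) (hεn : (3 : ℝ) ≤ ε * n)
    (H : Finset (Finset (Fin n))) (hH : IsUniform3 H)
    (hδ : ((1 / 3 : ℝ) + ε) * n ≤ (minCodeg H : ℝ))
    (hfree : ¬ HasHomTightCycle 11 H) :
    ∀ e ∈ H, ∃ x y z : Fin n, ({x, y, z} : Finset (Fin n)) = e ∧
      ArcD H y x ∧ ArcD H z x ∧
      ¬ ArcD H x y ∧ ¬ ArcD H x z ∧ ¬ ArcD H y z ∧ ¬ ArcD H z y ∧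
      BasePair H y z ∧ ¬ BasePair H x y ∧ ¬ BasePair H x z := by
  intro e he
  have hcard : Fintype.card (Fin n) < 3 * minCodeg H := by
    rw [Fintype.card_fin]
    have : (n : ℝ) < 3 * (minCodeg H : ℝ) := by linarith
    exact_mod_cast this
  obtain ⟨x, y, z, w, rfl, hxyw, hxzw⟩ := exists_apex_of_card_lt hH hcard he
  exact ⟨x, y, z, rfl, edge_structure_of_apex hH hfree he hxyw hxzw⟩
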